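/- Fix n ≥ 4 and let X_n = {x_{ij} : 1 ≤ i < j ≤ n}, whose elements correspond to the edges of the complete graph K_n on vertex set {1, …, n}. For a set E of edges of K_n, the following are equivalent: (1) CM_n ∩ ℚ[{x_{ij} : ij ∈ E}] = {0}; (2) E is (2,3)-sparse, i.e., every nonempty subset E' ⊆ E satisfies |E'| ≤ 2k − 3, where k is the number of vertices incident to at least one edge of E'. -/

import Mathlib

noncomputable section

/-- The set of variables `X_n = {x_{ij} : 1 ≤ i < j ≤ n}`, realized as unordered
pairs of distinct elements of `Fin n`. -/
abbrev XVar (n : ℕ) : Type := {e : Sym2 (Fin n) // ¬ e.IsDiag}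

/-- The Cayley–Menger matrix on `n` points: the `(n+1) × (n+1)` symmetric matrix with
rows and columns indexed by `0, 1, …, n`, with entry `0` at `(0,0)`, entries `1` at
`(0,i)` and `(i,0)` for `i ≥ 1`, entries `0` on the diagonal, and variable `x_{ij}`
at positions `(i,j)` and `(j,i)` for distinct `i, j ≥ 1`. -/
def cmMatrix (n : ℕ) : Matrix (Fin (n + 1)) (Fin (n + 1)) (MvPolynomial (XVar n) ℚ) :=
  Matrix.of fun i j =>
    if hij : i = j then 0
    else if hi : i = 0 then 1
    else if hj : j = 0 then 1
    else MvPolynomial.X ⟨s(i.pred hi, j.pred hj), by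
      rw [Sym2.mk_isDiag_iff]
      exact fun h => hij (by
        have := congrArg (Fin.succ) h
        rwa [Fin.succ_pred, Fin.succ_pred] at this)⟩

/-- The Cayley–Menger ideal `CM_n ⊆ ℚ[X_n]`: the ideal generated by all `5 × 5`
minors of the Cayley–Menger matrix on `n` points. -/
def cmIdeal (n : ℕ) : Ideal (MvPolynomial (XVar n) ℚ) :=
  Ideal.span { p | ∃ (r c : Fin 5 → Fin (n + 1)),
    Function.Injective r ∧ Function.Injective c ∧
    p = ((cmMatrix n).submatrix r c).det }

open scoped Classical

/-- The vertices of `Fin n` incident to at least one edge of `E'`. -/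
def incidentVertices (n : ℕ) (E' : Finset (XVar n)) : Finset (Fin n) :=
  Finset.univ.filter (fun v => ∃ e ∈ E', v ∈ e.1)

/-- A set `E` of edges of `K_n` is `(2,3)`-sparse: every nonempty subset `E' ⊆ E`
has at most `2k - 3` edges, where `k` is the number of vertices incident to `E'`. -/
def IsSparse (n : ℕ) (E : Finset (XVar n)) : Prop :=
  ∀ E' ⊆ E, E'.Nonempty → E'.card ≤ 2 * (incidentVertices n E').card - 3

section PlaneRigidity

open Finset

section Sparsity

variable {V : Type*} [DecidableEq V]

/-- The edges of `E` with both ends in `X`. -/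
def edgesWithin (E : Finset (Sym2 V)) (X : Finset V) : Finset (Sym2 V) :=
  E.filter fun e => e ∈ X.sym2

/-- The edges of `E` incident to `v`. -/
def edgesAt (E : Finset (Sym2 V)) (v : V) : Finset (Sym2 V) :=
  E.filter fun e => v ∈ e

/-- `(2,3)`-sparsity of a loopless edge set, expressed through the edges spanned by vertex sets. -/
structure VertexSparse (E : Finset (Sym2 V)) : Prop where
  not_isDiag : ∀ e ∈ E, ¬ e.IsDiag
  card_le : ∀ X : Finset V, 2 ≤ #X → #(edgesWithin E X) + 3 ≤ 2 * #X

lemma VertexSparse.mono {E F : Finset (Sym2 V)} (h : VertexSparse E) (hF : F ⊆ E) :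
    VertexSparse F where
  not_isDiag e he := h.not_isDiag e (hF he)
  card_le X hX := by
    have h₁ : #(edgesWithin F X) ≤ #(edgesWithin E X) := card_le_card (filter_subset_filter _ hF)
    have h₂ := h.card_le X hX
    omega

lemma card_edgesWithin_add_le (E : Finset (Sym2 V)) (X Y : Finset V) :
    #(edgesWithin E X) + #(edgesWithin E Y) ≤
      #(edgesWithin E (X ∪ Y)) + #(edgesWithin E (X ∩ Y)) := by
  rw [← card_union_add_card_inter]
  refine add_le_add (card_le_card ?_) (card_le_card ?_)
  · intro e
    simp only [edgesWithin, mem_union, mem_filter, mem_sym2_iff]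
    rintro (⟨h, h'⟩ | ⟨h, h'⟩)
    · exact ⟨h, fun a ha => Or.inl (h' a ha)⟩
    · exact ⟨h, fun a ha => Or.inr (h' a ha)⟩
  · intro e
    simp only [edgesWithin, mem_inter, mem_filter, mem_sym2_iff]
    rintro ⟨⟨h, h'⟩, -, h''⟩
    exact ⟨h, fun a ha => ⟨h' a ha, h'' a ha⟩⟩

/-- A vertex set on which the sparsity count of `E` is attained. -/
def IsTight (E : Finset (Sym2 V)) (X : Finset V) : Prop :=
  2 ≤ #X ∧ 2 * #X ≤ #(edgesWithin E X) + 3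

lemma VertexSparse.isTight_union {E : Finset (Sym2 V)} (h : VertexSparse E) {X Y : Finset V}
    (hX : IsTight E X) (hY : IsTight E Y) (hXY : 2 ≤ #(X ∩ Y)) : IsTight E (X ∪ Y) := by
  have h₁ := card_edgesWithin_add_le E X Y
  have h₂ := h.card_le _ hXY
  have h₃ := card_union_add_card_inter X Y
  have h₄ : #X ≤ #(X ∪ Y) := card_le_card subset_union_left
  obtain ⟨a, b⟩ := hX
  obtain ⟨c, d⟩ := hY
  exact ⟨by omega, by omega⟩

lemma VertexSparse.disjoint_edgesWithin {E : Finset (Sym2 V)} (h : VertexSparse E)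
    {X Y : Finset V} (hXY : #(X ∩ Y) ≤ 1) : Disjoint (edgesWithin E X) (edgesWithin E Y) := by
  rw [disjoint_left]
  intro e hX hY
  simp only [edgesWithin, mem_filter, mem_sym2_iff] at hX hY
  induction e with
  | _ x y =>
    refine h.not_isDiag _ hX.1 ?_
    rw [Sym2.mk_isDiag_iff]
    refine card_le_one.1 hXY x ?_ y ?_ <;> simp [hX.2, hY.2]

/-- Three tight sets meeting pairwise, each containing two of three given vertices,
yield a tight set containing all three vertices. -/
lemma VertexSparse.exists_isTight_of_three {E : Finset (Sym2 V)} (h : VertexSparse E)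
    {x y z : V} (hxy : x ≠ y) {X Y Z : Finset V}
    (hX : IsTight E X) (hY : IsTight E Y) (hZ : IsTight E Z)
    (hXy : y ∈ X) (hXz : z ∈ X) (hYx : x ∈ Y) (hYz : z ∈ Y) (hZx : x ∈ Z) (hZy : y ∈ Z) :
    ∃ W ⊆ X ∪ Y ∪ Z, IsTight E W ∧ x ∈ W ∧ y ∈ W ∧ z ∈ W := by
  by_cases h₁ : 2 ≤ #(X ∩ Y)
  · exact ⟨X ∪ Y, by grind, h.isTight_union hX hY h₁, by simp [*], by simp [*], by simp [*]⟩
  by_cases h₂ : 2 ≤ #(X ∩ Z)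
  · exact ⟨X ∪ Z, by grind, h.isTight_union hX hZ h₂, by simp [*], by simp [*], by simp [*]⟩
  by_cases h₃ : 2 ≤ #(Y ∩ Z)
  · exact ⟨Y ∪ Z, by grind, h.isTight_union hY hZ h₃, by simp [*], by simp [*], by simp [*]⟩
  refine ⟨X ∪ Y ∪ Z, Subset.rfl, ⟨?_, ?_⟩, by simp [*], by simp [*], by simp [*]⟩
  · exact hX.1.trans (card_le_card (by grind))
  have hU : #(edgesWithin E X ∪ edgesWithin E Y ∪ edgesWithin E Z) ≤
      #(edgesWithin E (X ∪ Y ∪ Z)) := by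
    refine card_le_card fun e => ?_
    simp only [edgesWithin, mem_union, mem_filter, mem_sym2_iff]
    grind
  rw [card_union_of_disjoint (disjoint_union_left.2
      ⟨h.disjoint_edgesWithin (by omega), h.disjoint_edgesWithin (by omega)⟩),
    card_union_of_disjoint (h.disjoint_edgesWithin (by omega))] at hU
  have h₄ := card_union_add_card_inter X Y
  have h₅ := card_union_add_card_inter (X ∪ Y) Z
  have h₆ : 1 ≤ #(X ∩ Y) := card_pos.2 ⟨z, by simp [*]⟩
  have h₇ : 2 ≤ #((X ∪ Y) ∩ Z) := by
    rw [← card_pair hxy]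
    exact card_le_card (by grind)
  obtain ⟨-, a⟩ := hX
  obtain ⟨-, b⟩ := hY
  obtain ⟨-, c⟩ := hZ
  omega

/-- A vertex of degree three in a sparse graph admits an inverse 1-extension. -/
lemma VertexSparse.exists_insert {E : Finset (Sym2 V)} (h : VertexSparse E) {v : V}
    (hv : #(edgesAt E v) = 3) :
    ∃ u w z, u ≠ v ∧ w ≠ v ∧ z ≠ v ∧ u ≠ w ∧ u ≠ z ∧ w ≠ z ∧
      edgesAt E v = {s(v, u), s(v, w), s(v, z)} ∧ s(u, w) ∉ E ∧
      VertexSparse (insert s(u, w) (E \ edgesAt E v)) := by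
  obtain ⟨e, f, g, hef, heg, hfg, hE⟩ := card_eq_three.1 hv
  have key : ∀ e ∈ edgesAt E v, ∃ u, u ≠ v ∧ e = s(v, u) := by
    intro e he
    simp only [edgesAt, mem_filter] at he
    obtain ⟨u, rfl⟩ := Sym2.mem_iff_exists.1 he.2
    exact ⟨u, fun huv => h.not_isDiag _ he.1 (by simp [huv]), rfl⟩
  obtain ⟨x, hx, rfl⟩ := key e (by simp [hE])
  obtain ⟨y, hy, rfl⟩ := key f (by simp [hE])
  obtain ⟨z, hz, rfl⟩ := key g (by simp [hE])
  have hxy : x ≠ y := by rintro rfl; exact hef rfl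
  have hxz : x ≠ z := by rintro rfl; exact heg rfl
  have hyz : y ≠ z := by rintro rfl; exact hfg rfl
  have hF : VertexSparse (E \ edgesAt E v) := h.mono sdiff_subset
  have hFv : ∀ e ∈ E \ edgesAt E v, v ∉ e := by
    intro e he
    simp only [edgesAt, mem_sdiff, mem_filter] at he
    tauto
  -- a pair not contained in a tight set can be inserted
  have hins : ∀ u w, u ≠ v → w ≠ v → u ≠ w →
      (¬ ∃ X, IsTight (E \ edgesAt E v) X ∧ u ∈ X ∧ w ∈ X ∧ v ∉ X) →
      s(u, w) ∉ E ∧ VertexSparse (insert s(u, w) (E \ edgesAt E v)) := by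
    intro u w hu hw huw hX
    refine ⟨fun huE => hX ⟨{u, w}, ⟨by rw [card_pair huw], ?_⟩, by simp, by simp, ?_⟩, ?_, ?_⟩
    · have : s(u, w) ∈ edgesWithin (E \ edgesAt E v) {u, w} := by
        simp only [edgesWithin, edgesAt, mem_filter, mem_sdiff, mk_mem_sym2_iff]
        refine ⟨⟨huE, fun h' => ?_⟩, by simp, by simp⟩
        rcases Sym2.mem_iff.1 h'.2 with h' | h'
        exacts [hu h'.symm, hw h'.symm]
      have := card_pos.2 ⟨_, this⟩
      rw [card_pair huw]
      omega
    · simp [hu.symm, hw.symm]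
    · intro e he
      rcases mem_insert.1 he with rfl | he
      · simpa using huw
      · exact hF.not_isDiag e he
    · intro X hX2
      by_cases huX : u ∈ X ∧ w ∈ X
      · have hXv : 2 ≤ #(X.erase v) := by
          rw [← card_pair huw]
          exact card_le_card (by grind)
        have h₁ := hF.card_le _ hXv
        have h₂ : ¬ 2 * #(X.erase v) ≤ #(edgesWithin (E \ edgesAt E v) (X.erase v)) + 3 :=
          fun h' => hX ⟨X.erase v, ⟨hXv, h'⟩, by grind, by grind, by grind⟩
        have h₃ : #(X.erase v) ≤ #X := card_le_card (erase_subset _ _)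
        have h₄ : edgesWithin (insert s(u, w) (E \ edgesAt E v)) X ⊆
            insert s(u, w) (edgesWithin (E \ edgesAt E v) (X.erase v)) := by
          intro e
          have := hFv e
          simp only [edgesWithin, mem_insert, mem_filter, mem_sym2_iff, mem_erase]
          rintro ⟨rfl | he, h'⟩
          · exact Or.inl rfl
          · exact Or.inr ⟨he, fun a ha => ⟨fun hav => hFv e he (hav ▸ ha), h' a ha⟩⟩
        have h₅ := (card_le_card h₄).trans (card_insert_le _ _)
        omega
      · have h₄ : edgesWithin (insert s(u, w) (E \ edgesAt E v)) X ⊆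
            edgesWithin (E \ edgesAt E v) X := by
          intro e
          simp only [edgesWithin, mem_insert, mem_filter]
          rintro ⟨rfl | he, h'⟩
          · exact absurd (mk_mem_sym2_iff.1 h') huX
          · exact ⟨he, h'⟩
        have h₅ := card_le_card h₄
        have h₆ := hF.card_le X hX2
        omega
  by_cases h₁ : ∃ X, IsTight (E \ edgesAt E v) X ∧ x ∈ X ∧ y ∈ X ∧ v ∉ X
  swap
  · obtain ⟨h₂, h₃⟩ := hins x y hx hy hxy h₁
    exact ⟨x, y, z, hx, hy, hz, hxy, hxz, hyz, hE, h₂, h₃⟩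
  by_cases h₂ : ∃ X, IsTight (E \ edgesAt E v) X ∧ x ∈ X ∧ z ∈ X ∧ v ∉ X
  swap
  · obtain ⟨h₂, h₃⟩ := hins x z hx hz hxz h₂
    exact ⟨x, z, y, hx, hz, hy, hxz, hxy, hyz.symm, by rw [hE, pair_comm s(v, y)], h₂, h₃⟩
  by_cases h₃ : ∃ X, IsTight (E \ edgesAt E v) X ∧ y ∈ X ∧ z ∈ X ∧ v ∉ X
  swap
  · obtain ⟨h₂, h₃⟩ := hins y z hy hz hyz h₃
    refine ⟨y, z, x, hy, hz, hx, hyz, hxy.symm, hxz.symm, ?_, h₂, h₃⟩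
    rw [hE, insert_comm, pair_comm s(v, x)]
  exfalso
  obtain ⟨Z, hZ, hZx, hZy, hZv⟩ := h₁
  obtain ⟨Y, hY, hYx, hYz, hYv⟩ := h₂
  obtain ⟨X, hX, hXy, hXz, hXv⟩ := h₃
  obtain ⟨W, hW, ⟨hW₂, hWt⟩, hWx, hWy, hWz⟩ :=
    hF.exists_isTight_of_three hxy hX hY hZ hXy hXz hYx hYz hZx hZy
  have hvW : v ∉ W := fun hvW => by
    have := hW hvW
    simp only [mem_union] at this
    tauto
  have h₁ := h.card_le (insert v W) (by rw [card_insert_of_notMem hvW]; omega)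
  have h₂ : edgesWithin (E \ edgesAt E v) W ∪ edgesAt E v ⊆ edgesWithin E (insert v W) := by
    intro e he
    rcases mem_union.1 he with he | he
    · simp only [edgesWithin, mem_filter, mem_sdiff, mem_sym2_iff] at he ⊢
      exact ⟨he.1.1, fun a ha => mem_insert_of_mem (he.2 a ha)⟩
    · have heE : e ∈ E := (mem_filter.1 he).1
      refine mem_filter.2 ⟨heE, ?_⟩
      rw [hE] at he
      simp only [mem_insert, mem_singleton] at he
      rcases he with rfl | rfl | rfl <;> simp [*]
  have h₃ : Disjoint (edgesWithin (E \ edgesAt E v) W) (edgesAt E v) :=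
    disjoint_left.2 fun e he he' =>
      hFv e (mem_filter.1 he).1 (mem_filter.1 he').2
  have h₄ := card_le_card h₂
  rw [card_union_of_disjoint h₃, hv] at h₄
  rw [card_insert_of_notMem hvW] at h₁
  omega

/-- A nonempty sparse graph has a vertex of degree between one and three. -/
lemma VertexSparse.exists_card_edgesAt [Fintype V] {E : Finset (Sym2 V)} (h : VertexSparse E)
    (hE : E.Nonempty) : ∃ v, 1 ≤ #(edgesAt E v) ∧ #(edgesAt E v) ≤ 3 := by
  by_contra! hd
  set X : Finset V := univ.filter fun v => 1 ≤ #(edgesAt E v) with hXdef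
  have hEX : edgesWithin E X = E := by
    refine filter_true_of_mem fun e he => mem_sym2_iff.2 fun a ha => ?_
    exact mem_filter.2 ⟨mem_univ _, card_pos.2 ⟨e, mem_filter.2 ⟨he, ha⟩⟩⟩
  have hX2 : 2 ≤ #X := by
    obtain ⟨e, he⟩ := hE
    rw [← Sym2.card_toFinset_of_not_isDiag e (h.not_isDiag e he)]
    refine card_le_card fun a ha => ?_
    rw [← hEX] at he
    exact mem_sym2_iff.1 (mem_filter.1 he).2 a (by simpa using ha)
  have h₁ := h.card_le X hX2
  rw [hEX] at h₁
  have h₂ : ∑ v ∈ X, #(edgesAt E v) = ∑ e ∈ E, #(X.filter fun v => v ∈ e) :=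
    sum_card_bipartiteAbove_eq_sum_card_bipartiteBelow fun v e => v ∈ e
  have h₃ : ∑ e ∈ E, #(X.filter fun v => v ∈ e) ≤ ∑ e ∈ E, 2 := by
    refine sum_le_sum fun e he => ?_
    rw [← Sym2.card_toFinset_of_not_isDiag e (h.not_isDiag e he)]
    exact card_le_card fun a ha => by simpa using (mem_filter.1 ha).2
  have h₄ : ∑ v ∈ X, 4 ≤ ∑ v ∈ X, #(edgesAt E v) :=
    sum_le_sum fun v hv => hd v (mem_filter.1 hv).2
  simp only [sum_const, smul_eq_mul] at h₃ h₄
  omega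

end Sparsity

section Stress

variable {V : Type*} [DecidableEq V]

lemma eq_zero_of_edgesAt_subset {R : Type*} [Zero R] {E : Finset (Sym2 V)} {v : V}
    {S : Finset (Sym2 V)} (hS : edgesAt E v ⊆ S) {c : Sym2 V → R} (hc : ∀ e ∉ E, c e = 0)
    {x : V} (hx : s(v, x) ∉ S) : c s(v, x) = 0 :=
  hc _ fun h => hx (hS (mem_filter.2 ⟨h, by simp⟩))

variable [Fintype V]

/-- `c` is an equilibrium stress of the planar framework with joints `p`. -/
def IsEquilibrium {R : Type*} [CommRing R] (p : V → Fin 2 → R) (c : Sym2 V → R) : Prop :=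
  ∀ v k, ∑ u, c s(v, u) * (p v k - p u k) = 0

/-- The framework with edges `E` and joints `p` carries no nonzero equilibrium stress, i.e. the
rows of its rigidity matrix are linearly independent. -/
def StressFree {R : Type*} [CommRing R] (E : Finset (Sym2 V)) (p : V → Fin 2 → R) : Prop :=
  ∀ c : Sym2 V → R, (∀ e ∉ E, c e = 0) → IsEquilibrium p c → c = 0

/-- The rigidity matrix of the complete graph. -/
def rigidityMatrix {R : Type*} [CommRing R] (p : V → Fin 2 → R) :
    Matrix (Sym2 V) (V × Fin 2) R :=
  Matrix.of fun e i => ∑ u, if s(i.1, u) = e then p i.1 i.2 - p u i.2 else 0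

lemma sum_mul_rigidityMatrix {R : Type*} [CommRing R] (p : V → Fin 2 → R) (c : Sym2 V → R)
    (i : V × Fin 2) :
    ∑ e, c e * rigidityMatrix p e i = ∑ u, c s(i.1, u) * (p i.1 i.2 - p u i.2) := by
  simp only [rigidityMatrix, Matrix.of_apply, mul_sum, mul_ite, mul_zero]
  rw [sum_comm]
  simp

lemma rigidityMatrix_map {R S : Type*} [CommRing R] [CommRing S] (f : R →+* S)
    (p : V → Fin 2 → R) (e : Sym2 V) (i : V × Fin 2) :
    f (rigidityMatrix p e i) = rigidityMatrix (fun v k => f (p v k)) e i := by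
  simp [rigidityMatrix, apply_ite f]

/-- The rows of the rigidity matrix indexed by `E`. -/
def edgeRows {R : Type*} [CommRing R] (E : Finset (Sym2 V)) (p : V → Fin 2 → R) :
    Matrix E (V × Fin 2) R :=
  (rigidityMatrix p).submatrix Subtype.val id

lemma stressFree_iff_vecMul {R : Type*} [CommRing R] {E : Finset (Sym2 V)}
    {p : V → Fin 2 → R} :
    StressFree E p ↔ ∀ c : E → R, Matrix.vecMul c (edgeRows E p) = 0 → c = 0 := by
  have key : ∀ c : Sym2 V → R, (∀ e ∉ E, c e = 0) → ∀ i : V × Fin 2,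
      Matrix.vecMul (fun e : E => c e) (edgeRows E p) i =
        ∑ u, c s(i.1, u) * (p i.1 i.2 - p u i.2) := by
    intro c hc i
    rw [← sum_mul_rigidityMatrix]
    simp only [Matrix.vecMul, dotProduct, edgeRows, Matrix.submatrix_apply, id]
    rw [sum_coe_sort E fun e => c e * rigidityMatrix p e i]
    exact sum_subset (subset_univ _) fun e _ he => by rw [hc e he, zero_mul]
  constructor
  · intro h c hc
    set d : Sym2 V → R := fun e => if he : e ∈ E then c ⟨e, he⟩ else 0 with hd
    have hdc : (fun e : E => d e) = c := by ext e; simp [hd]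
    have hdE : ∀ e ∉ E, d e = 0 := fun e he => by simp [hd, he]
    have h0 := h d hdE fun v k => by
      rw [← key d hdE (v, k), hdc, hc]; rfl
    rw [← hdc, h0]
    rfl
  · intro h c hcE hc
    have h0 := h (fun e : E => c e) (by ext i; rw [key c hcE]; exact hc i.1 i.2)
    ext e
    by_cases he : e ∈ E
    · exact congrFun h0 ⟨e, he⟩
    · exact hcE e he

/-- Stress-freeness is a Zariski open condition; if it holds somewhere then it holds for the
generic framework. -/
lemma StressFree.exists_polynomial {E : Finset (Sym2 V)} {p : V → Fin 2 → ℚ}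
    (h : StressFree E p) :
    StressFree E (fun v k => (MvPolynomial.X (v, k) : MvPolynomial (V × Fin 2) ℚ)) ∧
    ∃ D : MvPolynomial (V × Fin 2) ℚ, D ≠ 0 ∧
      ∀ q : V × Fin 2 → ℚ, MvPolynomial.eval q D ≠ 0 → StressFree E fun v k => q (v, k) := by
  rw [stressFree_iff_vecMul] at h
  obtain ⟨g, hg⟩ := (Matrix.vecMulLinear (edgeRows E p)).exists_leftInverse_of_injective
    (by rw [LinearMap.ker_eq_bot']; exact h)
  set B : Matrix (V × Fin 2) E ℚ := (LinearMap.toMatrix' g).transpose with hB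
  have hpB : edgeRows E p * B = 1 := by
    refine Matrix.ext_of_single_vecMul fun e => ?_
    rw [← Matrix.vecMul_vecMul, Matrix.vecMul_one, hB, Matrix.vecMul_transpose,
      LinearMap.toMatrix'_mulVec]
    exact LinearMap.congr_fun hg _
  set P : V → Fin 2 → MvPolynomial (V × Fin 2) ℚ := fun v k => MvPolynomial.X (v, k) with hP
  set B' : Matrix (V × Fin 2) E (MvPolynomial (V × Fin 2) ℚ) := B.map MvPolynomial.C with hB'
  set D := (edgeRows E P * B').det with hD
  have heval : ∀ q : V × Fin 2 → ℚ, MvPolynomial.eval q D =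
      (edgeRows E (fun v k => q (v, k)) * B).det := by
    intro q
    rw [hD, RingHom.map_det, RingHom.mapMatrix_apply, Matrix.map_mul]
    congr 2
    · ext e i
      simp [edgeRows, rigidityMatrix_map, hP]
    · ext i e
      simp [hB']
  have hD0 : D ≠ 0 := by
    intro h0
    have := heval fun i => p i.1 i.2
    rw [h0, map_zero] at this
    simp [hpB] at this
  refine ⟨?_, D, hD0, fun q hq => ?_⟩ <;> rw [stressFree_iff_vecMul] <;> intro c hc
  · refine Matrix.eq_zero_of_vecMul_eq_zero hD0 ?_
    rw [← Matrix.vecMul_vecMul, hc, Matrix.zero_vecMul]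
  · rw [heval] at hq
    refine Matrix.eq_zero_of_vecMul_eq_zero hq ?_
    rw [← Matrix.vecMul_vecMul, hc, Matrix.zero_vecMul]

lemma StressFree.exists_eval_ne_zero {E : Finset (Sym2 V)} {p : V → Fin 2 → ℚ}
    (h : StressFree E p) {f : MvPolynomial (V × Fin 2) ℚ} (hf : f ≠ 0) :
    ∃ q : V × Fin 2 → ℚ, (StressFree E fun v k => q (v, k)) ∧ MvPolynomial.eval q f ≠ 0 := by
  obtain ⟨-, D, hD, hDq⟩ := h.exists_polynomial
  by_contra! hq
  refine mul_ne_zero hD hf (MvPolynomial.funext fun q => ?_)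
  rw [map_mul, map_zero]
  by_cases h0 : MvPolynomial.eval q D = 0
  · rw [h0, zero_mul]
  · rw [hq q (hDq q h0), mul_zero]

/-- A stress vanishing at `v` does not depend on the position of `v`. -/
lemma IsEquilibrium.of_update {R : Type*} [CommRing R] {p : V → Fin 2 → R} {v : V}
    {q : Fin 2 → R} {c : Sym2 V → R} (hc : IsEquilibrium (Function.update p v q) c)
    (h0 : ∀ u, c s(v, u) = 0) : IsEquilibrium p c := by
  intro x k
  rw [← hc x k]
  refine sum_congr rfl fun y _ => ?_
  by_cases hx : x = v
  · subst hx; simp [h0]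
  by_cases hy : y = v
  · subst hy; simp [Sym2.eq_swap (a := x), h0]
  simp [hx, hy]

/-- A 0-extension of a stress-free framework is stress-free. -/
lemma StressFree.zero_extension {E : Finset (Sym2 V)} {v u w : V} (hu : u ≠ v)
    (hw : w ≠ v) (hE : edgesAt E v ⊆ {s(v, u), s(v, w)}) {p : V → Fin 2 → ℚ}
    (h : StressFree (E \ edgesAt E v) p) : ∃ q : V → Fin 2 → ℚ, StressFree E q := by
  obtain ⟨p, hp, huw⟩ : ∃ p : V → Fin 2 → ℚ, StressFree (E \ edgesAt E v) p ∧
      (u = w ∨ p u 0 ≠ p w 0) := by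
    by_cases huw : u = w
    · exact ⟨p, h, Or.inl huw⟩
    · obtain ⟨q, hq, hq'⟩ := h.exists_eval_ne_zero
        (f := MvPolynomial.X (u, 0) - MvPolynomial.X (w, 0))
        (sub_ne_zero.2 fun h' => huw (by simpa using MvPolynomial.X_injective h'))
      exact ⟨_, hq, Or.inr (by simpa [sub_eq_zero] using hq')⟩
  refine ⟨Function.update p v ![p u 0, p u 1 + 1], fun c hcE hc => ?_⟩
  have hx : ∀ x, x ≠ u → x ≠ w → c s(v, x) = 0 := fun x hxu hxw =>
    eq_zero_of_edgesAt_subset hE hcE (by simp [hxu, hxw, hu.symm, hw.symm])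
  have hsum : ∀ k, (∑ x ∈ {u, w}, c s(v, x) * (![p u 0, p u 1 + 1] k - p x k)) = 0 := by
    intro k
    rw [← hc v k, ← sum_subset (subset_univ ({u, w} : Finset V))]
    · refine sum_congr rfl fun x hx => ?_
      have hxv : x ≠ v := by
        rcases mem_insert.1 hx with rfl | hx
        · exact hu
        · rw [mem_singleton.1 hx]; exact hw
      simp [hxv]
    · intro x _ hx'
      simp only [mem_insert, mem_singleton, not_or] at hx'
      rw [hx x hx'.1 hx'.2, zero_mul]
  have h0 := hsum 0
  have h1 := hsum 1
  have huw0 : c s(v, u) = 0 ∧ c s(v, w) = 0 := by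
    by_cases huw' : u = w
    · subst huw'
      simp at h1
      exact ⟨h1, h1⟩
    · rw [sum_pair huw'] at h0 h1
      have hne := huw.resolve_left huw'
      simp [sub_eq_zero, hne] at h0 h1
      simpa [h0] using h1
  have hv : ∀ x, c s(v, x) = 0 := by
    intro x
    by_cases hxu : x = u
    · rw [hxu, huw0.1]
    by_cases hxw : x = w
    · rw [hxw, huw0.2]
    exact hx x hxu hxw
  refine hp c (fun e he => ?_) (hc.of_update hv)
  by_cases heE : e ∈ E
  · simp only [edgesAt, mem_sdiff, mem_filter, heE, true_and, not_not] at he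
    obtain ⟨x, rfl⟩ := Sym2.mem_iff_exists.1 he
    exact hv x
  · exact hcE e heE

/-- A 1-extension of a stress-free framework is stress-free. -/
lemma StressFree.one_extension {E : Finset (Sym2 V)} {v u w z : V} (hu : u ≠ v)
    (hw : w ≠ v) (hz : z ≠ v) (huw : u ≠ w) (huz : u ≠ z) (hwz : w ≠ z)
    (hE : edgesAt E v ⊆ {s(v, u), s(v, w), s(v, z)}) (huwE : s(u, w) ∉ E) {p : V → Fin 2 → ℚ}
    (h : StressFree (insert s(u, w) (E \ edgesAt E v)) p) :
    ∃ q : V → Fin 2 → ℚ, StressFree E q := by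
  obtain ⟨p, hp, hcol⟩ : ∃ p : V → Fin 2 → ℚ,
      StressFree (insert s(u, w) (E \ edgesAt E v)) p ∧
      (p w 0 - p u 0) * (p z 1 - p u 1) - (p w 1 - p u 1) * (p z 0 - p u 0) ≠ 0 := by
    set f : MvPolynomial (V × Fin 2) ℚ :=
      (MvPolynomial.X (w, 0) - MvPolynomial.X (u, 0)) *
        (MvPolynomial.X (z, 1) - MvPolynomial.X (u, 1)) -
      (MvPolynomial.X (w, 1) - MvPolynomial.X (u, 1)) *
        (MvPolynomial.X (z, 0) - MvPolynomial.X (u, 0)) with hf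
    have hf0 : f ≠ 0 := by
      intro h0
      have := congrArg (MvPolynomial.eval fun i : V × Fin 2 =>
        if i = (w, 0) ∨ i = (z, 1) then (1 : ℚ) else 0) h0
      simp [hf, huw, huz, hwz, hwz.symm] at this
    obtain ⟨q, hq, hq'⟩ := h.exists_eval_ne_zero hf0
    exact ⟨_, hq, by simpa [hf] using hq'⟩
  set m : Fin 2 → ℚ := fun k => (p u k + p w k) / 2 with hm
  refine ⟨Function.update p v m, fun c hcE hc => ?_⟩
  have hx : ∀ x, x ≠ u → x ≠ w → x ≠ z → c s(v, x) = 0 := fun x hxu hxw hxz =>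
    eq_zero_of_edgesAt_subset hE hcE
      (by simp [hxu, hxw, hxz, hu.symm, hw.symm, hz.symm])
  have hsum : ∀ k, c s(v, u) * (m k - p u k) + (c s(v, w) * (m k - p w k) +
      c s(v, z) * (m k - p z k)) = 0 := by
    intro k
    rw [← hc v k, ← sum_subset (subset_univ ({u, w, z} : Finset V)),
      sum_insert (by simp [huw, huz]), sum_pair hwz]
    · simp [hu, hw, hz]
    · intro x _ hx'
      simp only [mem_insert, mem_singleton, not_or] at hx'
      rw [hx x hx'.1 hx'.2.1 hx'.2.2, zero_mul]
  have h0 := hsum 0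
  have h1 := hsum 1
  simp only [hm] at h0 h1
  have hvz : c s(v, z) = 0 := by
    refine (mul_eq_zero.1 ?_).resolve_right hcol
    linear_combination (p w 1 - p u 1) * h0 - (p w 0 - p u 0) * h1
  have hvuw : c s(v, u) = c s(v, w) := by
    refine sub_eq_zero.1 ((mul_eq_zero.1 ?_).resolve_right hcol)
    rw [hvz] at h0 h1
    linear_combination 2 * (p z 1 - p u 1) * h0 - 2 * (p z 0 - p u 0) * h1
  set d : Sym2 V → ℚ := fun e =>
    if v ∈ e then 0 else if e = s(u, w) then c s(v, u) / 2 else c e with hd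
  have hdE : ∀ e ∉ insert s(u, w) (E \ edgesAt E v), d e = 0 := by
    intro e he
    simp only [mem_insert, edgesAt, mem_sdiff, mem_filter, not_or, not_and] at he
    by_cases hve : v ∈ e
    · simp [hd, hve]
    · simp only [hd, hve, he.1, if_false]
      exact hcE e fun h' => he.2 h' fun _ => hve
  have hterm : ∀ x y k, x ≠ v → d s(x, y) * (p x k - p y k) =
      c s(x, y) * (Function.update p v m x k - Function.update p v m y k)
        - (if y = v then c s(v, x) * (p x k - m k) else 0)
        + (if y = w then if x = u then c s(v, u) / 2 * (p u k - p w k) else 0 else 0)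
        + (if y = u then if x = w then c s(v, u) / 2 * (p w k - p u k) else 0 else 0) := by
    intro x y k hxv
    have huw0 := hcE _ huwE
    by_cases hyv : y = v
    · subst hyv
      simp [hd, hxv, hu.symm, hw.symm, Sym2.eq_swap (a := x)]
    have hv : v ∉ s(x, y) := by simp [Ne.symm hxv, Ne.symm hyv]
    by_cases he : s(x, y) = s(u, w)
    · rcases Sym2.eq_iff.1 he with ⟨rfl, rfl⟩ | ⟨rfl, rfl⟩
      · simp [hd, hv, hxv, hyv, huw, huw0]
      · simp [hd, he, hxv, hyv, Ne.symm hxv, Ne.symm hyv, huw, huw0]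
    · have h₁ : ¬ (y = w ∧ x = u) := by rintro ⟨rfl, rfl⟩; exact he rfl
      have h₂ : ¬ (y = u ∧ x = w) := by rintro ⟨rfl, rfl⟩; exact he Sym2.eq_swap
      simp only [hd, hv, he, if_false, hyv, Function.update_of_ne hxv, Function.update_of_ne hyv,
        ← ite_and, h₁, h₂]
      ring
  have hdeq : IsEquilibrium p d := by
    intro x k
    by_cases hxv : x = v
    · subst hxv; simp [hd]
    simp only [hterm x _ k hxv, sum_add_distrib, sum_sub_distrib, sum_ite_eq', mem_univ, if_true]
    rw [hc x k]
    by_cases hxu : x = u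
    · subst hxu
      simp only [huw, if_true, if_false, hm]
      ring
    by_cases hxw : x = w
    · subst hxw
      simp only [hxu, if_true, if_false, hm, ← hvuw]
      ring
    by_cases hxz : x = z
    · subst hxz
      simp [hxu, hxw, hvz]
    · simp [hxu, hxw, hx x hxu hxw hxz]
  have hd0 : ∀ e, d e = 0 := fun e => congrFun (hp d hdE hdeq) e
  have hvu : c s(v, u) = 0 := by
    have := hd0 s(u, w)
    simpa [hd, hu.symm, hw.symm] using this
  ext e
  by_cases hve : v ∈ e
  · obtain ⟨x, rfl⟩ := Sym2.mem_iff_exists.1 hve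
    by_cases hxu : x = u
    · rw [hxu, hvu]; rfl
    by_cases hxw : x = w
    · rw [hxw, ← hvuw, hvu]; rfl
    by_cases hxz : x = z
    · rw [hxz, hvz]; rfl
    exact hx x hxu hxw hxz
  · by_cases he : e = s(u, w)
    · rw [he]; exact hcE _ huwE
    · simpa [hd, hve, he] using hd0 e

/-- The hard half of the Pollaczek-Geiringer-Laman theorem. -/
theorem VertexSparse.exists_stressFree {E : Finset (Sym2 V)} (h : VertexSparse E) :
    ∃ p : V → Fin 2 → ℚ, StressFree E p := by
  induction hn : #E using Nat.strong_induction_on generalizing E with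
  | _ n ih =>
    rcases E.eq_empty_or_nonempty with rfl | hne
    · exact ⟨0, fun c hc _ => funext fun e => hc e (notMem_empty e)⟩
    obtain ⟨v, hv1, hv3⟩ := h.exists_card_edgesAt hne
    have hsub : edgesAt E v ⊆ E := filter_subset _ _
    have hcard := card_sdiff_add_card_eq_card hsub
    by_cases hv : #(edgesAt E v) = 3
    · obtain ⟨u, w, z, hu, hw, hz, huw, huz, hwz, hE, huwE, hins⟩ := h.exists_insert hv
      have := card_insert_le s(u, w) (E \ edgesAt E v)
      obtain ⟨p, hp⟩ := ih _ (by omega) hins rfl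
      exact hp.one_extension hu hw hz huw huz hwz hE.subset huwE
    · obtain ⟨p, hp⟩ := ih _ (by omega) (h.mono (sdiff_subset (t := edgesAt E v))) rfl
      have key : ∀ e ∈ edgesAt E v, ∃ u, u ≠ v ∧ e = s(v, u) := by
        intro e he
        simp only [edgesAt, mem_filter] at he
        obtain ⟨u, rfl⟩ := Sym2.mem_iff_exists.1 he.2
        exact ⟨u, fun huv => h.not_isDiag _ he.1 (by simp [huv]), rfl⟩
      rcases (by omega : #(edgesAt E v) = 1 ∨ #(edgesAt E v) = 2) with h1 | h2
      · obtain ⟨e, he⟩ := card_eq_one.1 h1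
        obtain ⟨u, hu, rfl⟩ := key e (by simp [he])
        exact hp.zero_extension hu hu (by simp [he])
      · obtain ⟨e, f, -, he⟩ := card_eq_two.1 h2
        obtain ⟨u, hu, rfl⟩ := key e (by simp [he])
        obtain ⟨w, hw, rfl⟩ := key f (by simp [he])
        exact hp.zero_extension hu hw he.subset

end Stress

section SquaredDistance

variable {V : Type*}

/-- The squared distance between the ends of an edge of the planar framework with joints `p`. -/
def sqDist {R : Type*} [CommRing R] (p : V → Fin 2 → R) : Sym2 V → R :=
  Sym2.lift ⟨fun a b => ∑ k, (p a k - p b k) ^ 2, fun a b => sum_congr rfl fun k _ => by ring⟩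

lemma sqDist_mk {R : Type*} [CommRing R] (p : V → Fin 2 → R) (a b : V) :
    sqDist p s(a, b) = ∑ k, (p a k - p b k) ^ 2 := rfl

variable [DecidableEq V] [Fintype V]

/-- The joints of the generic planar framework. -/
def genericJoints (V : Type*) : V → Fin 2 → MvPolynomial (V × Fin 2) ℚ :=
  fun v k => MvPolynomial.X (v, k)

lemma pderiv_sqDist (i : V × Fin 2) (e : Sym2 V) :
    MvPolynomial.pderiv i (sqDist (genericJoints V) e) =
      2 * rigidityMatrix (genericJoints V) e i := by
  obtain ⟨v, k⟩ := i
  induction e with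
  | _ a b =>
    have h : ∀ u, (s(v, u) = s(a, b)) ↔ (v = a ∧ u = b) ∨ (v = b ∧ u = a) := fun u => Sym2.eq_iff
    simp only [sqDist_mk, map_sum, rigidityMatrix, Matrix.of_apply, h, genericJoints]
    by_cases hab : a = b
    · subst hab
      simp only [sub_self, or_self]
      by_cases hv : v = a <;> simp [hv]
    by_cases hva : v = a
    · subst hva
      fin_cases k <;> simp [hab, MvPolynomial.pderiv_X, Derivation.leibniz_pow,
        Pi.single_apply, Ne.symm hab]
    by_cases hvb : v = b
    · subst hvb
      fin_cases k <;> simp [hab, hva, MvPolynomial.pderiv_X, Derivation.leibniz_pow,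
        Pi.single_apply] <;> ring
    · simp [hva, hvb, MvPolynomial.pderiv_X, Derivation.leibniz_pow, Ne.symm hva, Ne.symm hvb]

lemma pderiv_aeval {σ τ : Type*} [Fintype σ] (f : σ → MvPolynomial τ ℚ) (P : MvPolynomial σ ℚ)
    (i : τ) : MvPolynomial.pderiv i (MvPolynomial.aeval f P) =
      ∑ s, MvPolynomial.aeval f (MvPolynomial.pderiv s P) * MvPolynomial.pderiv i (f s) := by
  induction P using MvPolynomial.induction_on with
  | C a => simp
  | add p q hp hq => simp only [map_add, hp, hq, add_mul, sum_add_distrib]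
  | mul_X p s hp =>
    simp only [map_mul, MvPolynomial.aeval_X, Derivation.leibniz, hp, smul_eq_mul, map_add,
      MvPolynomial.pderiv_X, add_mul, sum_add_distrib, mul_sum]
    congr 1
    · simp [Pi.single_apply, apply_ite]
    · exact sum_congr rfl fun t _ => by ring

/-- The Jacobian criterion for the squared distances of the generic framework. -/
theorem StressFree.algebraicIndependent {F : Finset (Sym2 V)}
    (h : StressFree F (genericJoints V)) :
    AlgebraicIndependent ℚ fun e : F => sqDist (genericJoints V) e := by
  rw [algebraicIndependent_iff]
  have key : ∀ (N : ℕ) (P : MvPolynomial F ℚ), (∀ m : F →₀ ℕ, N ≤ m.degree → P.coeff m = 0) →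
      MvPolynomial.aeval (fun e : F => sqDist (genericJoints V) e) P = 0 → P = 0 := by
    intro N
    induction N with
    | zero => exact fun P hP _ => MvPolynomial.ext _ _ fun m => by simp [hP m]
    | succ N ih =>
      intro P hP hP0
      have hc : (fun e : F => MvPolynomial.aeval (fun e : F => sqDist (genericJoints V) e)
          (MvPolynomial.pderiv e P)) = 0 := by
        refine stressFree_iff_vecMul.1 h _ ?_
        ext1 i
        have h0 := pderiv_aeval (fun e : F => sqDist (genericJoints V) e) P i
        simp only [hP0, map_zero, pderiv_sqDist, mul_left_comm _ (2 : MvPolynomial _ ℚ),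
          ← mul_sum] at h0
        exact (mul_eq_zero.1 h0.symm).resolve_left two_ne_zero
      have hd : ∀ e : F, MvPolynomial.pderiv e P = 0 := fun e =>
        ih _ (fun m hm => by
          rw [MvPolynomial.coeff_pderiv, hP _ (by simp [hm]), zero_mul]) (congrFun hc e)
      have hP' : P = MvPolynomial.C (P.coeff 0) := by
        ext m
        rw [MvPolynomial.coeff_C]
        split_ifs with hm
        · rw [hm]
        · obtain ⟨e, he⟩ := Finsupp.ne_iff.1 (Ne.symm hm)
          have h1 := congrArg (MvPolynomial.coeff (m - Finsupp.single e 1)) (hd e)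
          rw [MvPolynomial.coeff_pderiv, MvPolynomial.coeff_zero, tsub_add_cancel_of_le
            (Finsupp.single_le_iff.2 (Nat.one_le_iff_ne_zero.2 he))] at h1
          exact (mul_eq_zero.1 h1).resolve_right (by positivity)
      rw [hP'] at hP0 ⊢
      simpa using hP0
  exact fun P => key (P.totalDegree + 1) P fun m hm =>
    MvPolynomial.coeff_eq_zero_of_totalDegree_lt (by
      rw [Finsupp.degree] at hm
      exact hm)

end SquaredDistance

section CayleyMenger

variable {n : ℕ} {A : Type*} [CommRing A]

/-- The value of a specialization of the variables at an edge, with value zero at loops. -/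
def edgeValue (f : MvPolynomial (XVar n) ℚ →+* A) (e : Sym2 (Fin n)) : A :=
  if h : ¬ e.IsDiag then f (MvPolynomial.X ⟨e, h⟩) else 0

lemma edgeValue_coe (f : MvPolynomial (XVar n) ℚ →+* A) (e : XVar n) :
    edgeValue f e.1 = f (MvPolynomial.X e) := dif_pos e.2

lemma edgeValue_self (f : MvPolynomial (XVar n) ℚ →+* A) (a : Fin n) :
    edgeValue f s(a, a) = 0 := by simp [edgeValue]

lemma map_cmMatrix_zero_zero (f : MvPolynomial (XVar n) ℚ →+* A) : f (cmMatrix n 0 0) = 0 := by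
  simp [cmMatrix]

lemma map_cmMatrix_zero_succ (f : MvPolynomial (XVar n) ℚ →+* A) (i : Fin n) :
    f (cmMatrix n 0 i.succ) = 1 := by
  simp [cmMatrix, (Fin.succ_ne_zero i).symm]

lemma map_cmMatrix_succ_zero (f : MvPolynomial (XVar n) ℚ →+* A) (i : Fin n) :
    f (cmMatrix n i.succ 0) = 1 := by
  simp [cmMatrix]

lemma map_cmMatrix_succ_succ (f : MvPolynomial (XVar n) ℚ →+* A) (i j : Fin n) :
    f (cmMatrix n i.succ j.succ) = edgeValue f s(i, j) := by
  by_cases hij : i = j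
  · simp [cmMatrix, hij, edgeValue]
  · simp [cmMatrix, hij, edgeValue]

/-- The Cayley–Menger ideal vanishes on all planar point configurations. -/
lemma map_eq_zero_of_mem_cmIdeal (f : MvPolynomial (XVar n) ℚ →+* A) (p : Fin n → Fin 2 → A)
    (hf : ∀ e : XVar n, f (MvPolynomial.X e) = sqDist p e.1) {P : MvPolynomial (XVar n) ℚ}
    (hP : P ∈ cmIdeal n) : f P = 0 := by
  have hE : ∀ i j, edgeValue f s(i, j) = sqDist p s(i, j) := by
    intro i j
    by_cases hij : i = j
    · simp [hij, edgeValue, sqDist_mk]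
    · simp [edgeValue, hij, hf]
  have hle : cmIdeal n ≤ RingHom.ker f := by
    refine Ideal.span_le.2 ?_
    rintro _ ⟨r, c, -, -, rfl⟩
    set L : Fin (n + 1) → Fin 5 → A := Fin.cases ![1, 0, 0, 0, 0]
      fun i => ![p i 0 ^ 2 + p i 1 ^ 2, 1, -2 * p i 0, -2 * p i 1, 0] with hL
    set M : Fin (n + 1) → Fin 5 → A := Fin.cases ![0, 1, 0, 0, 0]
      fun i => ![1, p i 0 ^ 2 + p i 1 ^ 2, p i 0, p i 1, 0] with hM
    have hLM : ∀ i j, f (cmMatrix n i j) = ∑ k, L i k * M j k := by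
      intro i j
      refine Fin.cases ?_ (fun i => ?_) i <;> refine Fin.cases ?_ (fun j => ?_) j
      · simp [map_cmMatrix_zero_zero, hL, hM, Fin.sum_univ_five]
      · simp [map_cmMatrix_zero_succ, hL, hM, Fin.sum_univ_five]
      · simp [map_cmMatrix_succ_zero, hL, hM, Fin.sum_univ_five]
      · simp only [map_cmMatrix_succ_succ, hE, sqDist_mk, hL, hM, Fin.sum_univ_five,
          Fin.sum_univ_two, Fin.cases_succ]
        simp
        ring
    have hdet : f.mapMatrix ((cmMatrix n).submatrix r c) =
        Matrix.of (fun i k => L (r i) k) * Matrix.of (fun k j => M (c j) k) := by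
      ext i j
      simp [Matrix.mul_apply, hLM]
    rw [SetLike.mem_coe, RingHom.mem_ker, RingHom.map_det, hdet, Matrix.det_mul,
      Matrix.det_eq_zero_of_column_eq_zero 4, zero_mul]
    intro i
    rw [Matrix.of_apply]
    refine Fin.cases ?_ (fun j => ?_) (r i) <;> simp [hL]
  exact hle hP

/-- The Cayley–Menger determinant of four points as a quadratic in the last squared distance. -/
lemma det_cayleyMenger (x p q s t z : A) :
    Matrix.det !![0, 1, 1, 1, 1; 1, 0, x, p, q; 1, x, 0, s, t; 1, p, s, 0, z; 1, q, t, z, 0] =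
      -2 * (x * z ^ 2 + (x ^ 2 - x * (p + q + s + t) + (p - s) * (q - t)) * z +
        ((p - s - q + t) * (p * t - q * s) - x * (t - s) * (p - q))) := by
  simp [Matrix.det_succ_row_zero, Fin.sum_univ_succ, Fin.succAbove]
  ring

/-- The quadratic relation among the six squared distances of four points. -/
lemma det_edgeValue (f : MvPolynomial (XVar n) ℚ →+* A) (hf : ∀ P ∈ cmIdeal n, f P = 0)
    {a b i j : Fin n} (hab : a ≠ b) (hai : a ≠ i) (haj : a ≠ j) (hbi : b ≠ i) (hbj : b ≠ j)
    (hij : i ≠ j) :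
    Matrix.det !![0, 1, 1, 1, 1;
      1, 0, edgeValue f s(a, b), edgeValue f s(a, i), edgeValue f s(a, j);
      1, edgeValue f s(a, b), 0, edgeValue f s(b, i), edgeValue f s(b, j);
      1, edgeValue f s(a, i), edgeValue f s(b, i), 0, edgeValue f s(i, j);
      1, edgeValue f s(a, j), edgeValue f s(b, j), edgeValue f s(i, j), 0] = 0 := by
  set r : Fin 5 → Fin (n + 1) := ![0, a.succ, b.succ, i.succ, j.succ] with hr
  have hinj : Function.Injective r := by
    intro x y
    fin_cases x <;> fin_cases y <;>
      simp [hr, hab, hai, haj, hbi, hbj, hij, hab.symm, hai.symm, haj.symm, hbi.symm, hbj.symm,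
        hij.symm, (Fin.succ_ne_zero _).symm]
  have h := hf _ (Ideal.subset_span ⟨r, r, hinj, hinj, rfl⟩)
  rw [RingHom.map_det] at h
  refine Eq.trans (congrArg Matrix.det ?_) h
  ext x y
  rw [RingHom.mapMatrix_apply, Matrix.map_apply, Matrix.submatrix_apply]
  fin_cases x <;> fin_cases y <;>
    simp [hr, map_cmMatrix_zero_zero, map_cmMatrix_zero_succ, map_cmMatrix_succ_zero,
      map_cmMatrix_succ_succ, edgeValue_self, Sym2.eq_swap (a := b) (b := a),
      Sym2.eq_swap (a := i) (b := a), Sym2.eq_swap (a := j) (b := a),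
      Sym2.eq_swap (a := i) (b := b), Sym2.eq_swap (a := j) (b := b),
      Sym2.eq_swap (a := j) (b := i)]

lemma isAlgebraic_edgeValue [IsDomain A] [Algebra ℚ A] (f : MvPolynomial (XVar n) ℚ →+* A)
    (hf : ∀ P ∈ cmIdeal n, f P = 0) {S : Subalgebra ℚ A} {a b i j : Fin n} (hab : a ≠ b)
    (hai : a ≠ i) (haj : a ≠ j) (hbi : b ≠ i) (hbj : b ≠ j) (hij : i ≠ j)
    (h0 : edgeValue f s(a, b) ≠ 0) (hx : edgeValue f s(a, b) ∈ S) (hp : edgeValue f s(a, i) ∈ S)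
    (hq : edgeValue f s(a, j) ∈ S) (hs : edgeValue f s(b, i) ∈ S) (ht : edgeValue f s(b, j) ∈ S) :
    IsAlgebraic S (edgeValue f s(i, j)) := by
  have := algebraRat.charZero A
  have h := det_edgeValue f hf hab hai haj hbi hbj hij
  rw [det_cayleyMenger] at h
  lift edgeValue f s(a, b) to S using hx with x
  lift edgeValue f s(a, i) to S using hp with p
  lift edgeValue f s(a, j) to S using hq with q
  lift edgeValue f s(b, i) to S using hs with s
  lift edgeValue f s(b, j) to S using ht with t
  have hx0 : x ≠ 0 := fun hx => h0 (by simp [hx])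
  refine ⟨Polynomial.C x * Polynomial.X ^ 2 +
    Polynomial.C (x ^ 2 - x * (p + q + s + t) + (p - s) * (q - t)) * Polynomial.X +
    Polynomial.C ((p - s - q + t) * (p * t - q * s) - x * (t - s) * (p - q)), fun hP => ?_, ?_⟩
  · have := Polynomial.natDegree_quadratic
      (b := x ^ 2 - x * (p + q + s + t) + (p - s) * (q - t))
      (c := (p - s - q + t) * (p * t - q * s) - x * (t - s) * (p - q)) hx0
    rw [hP, Polynomial.natDegree_zero] at this
    omega
  · simpa [Algebra.algebraMap_ofSubsemiring_apply] using
      (mul_eq_zero.1 h).resolve_left (by norm_num)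

/-- On any component of the Cayley–Menger variety, the edges spanned by `k` vertices have
transcendence degree at most `2k - 3`. -/
lemma card_le_of_algebraicIndependent [IsDomain A] [Algebra ℚ A]
    (f : MvPolynomial (XVar n) ℚ →+* A) (hf : ∀ P ∈ cmIdeal n, f P = 0) {E : Finset (XVar n)}
    (hE : E.Nonempty) (hind : AlgebraicIndependent ℚ fun e : E => f (MvPolynomial.X e.1)) :
    #E ≤ 2 * #(incidentVertices n E) - 3 := by
  obtain ⟨⟨e, hed⟩, heE⟩ := hE
  induction e with
  | _ a b =>
  have hab : a ≠ b := hed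
  set W := incidentVertices n E with hW
  have haW : a ∈ W := mem_filter.2 ⟨mem_univ _, _, heE, by simp⟩
  have hbW : b ∈ W := mem_filter.2 ⟨mem_univ _, _, heE, by simp⟩
  have h0 : edgeValue f s(a, b) ≠ 0 := by
    have := hind.ne_zero ⟨_, heE⟩
    rwa [← edgeValue_coe] at this
  set U := (W.erase a).erase b with hU
  set B : Finset A := insert (edgeValue f s(a, b))
    (U.image (fun i => edgeValue f s(a, i)) ∪ U.image fun i => edgeValue f s(b, i)) with hB
  have hUcard : #U + 2 = #W := by
    have h₁ : #(W.erase a) + 1 = #W := card_erase_add_one haW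
    have h₂ : #U + 1 = #(W.erase a) := card_erase_add_one (mem_erase.2 ⟨hab.symm, hbW⟩)
    omega
  have hBcard : #B ≤ 2 * #W - 3 := by
    have h₁ : #B ≤ #(U.image (fun i => edgeValue f s(a, i)) ∪
      U.image fun i => edgeValue f s(b, i)) + 1 := card_insert_le _ _
    have h₂ := card_union_le (U.image fun i => edgeValue f s(a, i))
      (U.image fun i => edgeValue f s(b, i))
    have h₃ : #(U.image fun i => edgeValue f s(a, i)) ≤ #U := card_image_le
    have h₄ : #(U.image fun i => edgeValue f s(b, i)) ≤ #U := card_image_le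
    omega
  have hBab : edgeValue f s(a, b) ∈ Algebra.adjoin ℚ (B : Set A) :=
    Algebra.subset_adjoin (by simp [hB])
  have hBa : ∀ i ∈ W, i ≠ a → edgeValue f s(a, i) ∈ Algebra.adjoin ℚ (B : Set A) := by
    intro i hi hia
    by_cases hib : i = b
    · rwa [hib]
    · refine Algebra.subset_adjoin (mem_insert_of_mem (mem_union_left _ (mem_image_of_mem _ ?_)))
      exact mem_erase.2 ⟨hib, mem_erase.2 ⟨hia, hi⟩⟩
  have hBb : ∀ i ∈ W, i ≠ b → edgeValue f s(b, i) ∈ Algebra.adjoin ℚ (B : Set A) := by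
    intro i hi hib
    by_cases hia : i = a
    · rwa [hia, Sym2.eq_swap]
    · refine Algebra.subset_adjoin (mem_insert_of_mem (mem_union_right _ (mem_image_of_mem _ ?_)))
      exact mem_erase.2 ⟨hib, mem_erase.2 ⟨hia, hi⟩⟩
  have hmem : ∀ {x : A}, x ∈ Algebra.adjoin ℚ (B : Set A) →
      IsAlgebraic (Algebra.adjoin ℚ (B : Set A)) x :=
    fun {x} hx => isAlgebraic_algebraMap (⟨x, hx⟩ : Algebra.adjoin ℚ (B : Set A))
  have hsub : Set.range (fun e : E => f (MvPolynomial.X e.1)) ⊆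
      (AlgebraicIndependent.matroid ℚ A).closure B := by
    rw [AlgebraicIndependent.matroid_closure_eq]
    rintro _ ⟨⟨⟨e, hed⟩, heE⟩, rfl⟩
    simp only [SetLike.mem_coe, Subalgebra.mem_algebraicClosure, ← edgeValue_coe]
    induction e with
    | _ i j =>
    have hij : i ≠ j := hed
    have hi : i ∈ W := mem_filter.2 ⟨mem_univ _, _, heE, by simp⟩
    have hj : j ∈ W := mem_filter.2 ⟨mem_univ _, _, heE, by simp⟩
    by_cases hai : a = i
    · exact hmem (hai ▸ hBa j hj (hai ▸ hij.symm))
    by_cases haj : a = j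
    · rw [Sym2.eq_swap]
      exact hmem (haj ▸ hBa i hi (Ne.symm hai))
    by_cases hbi : b = i
    · exact hmem (hbi ▸ hBb j hj (hbi ▸ hij.symm))
    by_cases hbj : b = j
    · rw [Sym2.eq_swap]
      exact hmem (hbj ▸ hBb i hi (Ne.symm hbi))
    exact isAlgebraic_edgeValue f hf hab hai haj hbi hbj hij h0 hBab (hBa i hi (Ne.symm hai))
      (hBa j hj (Ne.symm haj)) (hBb i hi (Ne.symm hbi)) (hBb j hj (Ne.symm hbj))
  have hI : (AlgebraicIndependent.matroid ℚ A).Indep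
      (Set.range fun e : E => f (MvPolynomial.X e.1)) :=
    AlgebraicIndependent.matroid_indep_iff.2 hind.coe_range
  have hle := (hI.encard_le_eRk_of_subset hsub).trans
    ((Matroid.eRk_closure_eq _ _).trans_le (Matroid.eRk_le_encard _ _))
  have hle' : #E ≤ #B := by simpa using hind.injective.encard_range.trans hle
  exact hle'.trans hBcard

/-- The edge sets that are independent modulo the Cayley–Menger ideal are sparse. -/
lemma isSparse_of_independent {E : Finset (XVar n)}
    (h : ∀ p ∈ cmIdeal n, p ∈ MvPolynomial.supported ℚ (E : Set (XVar n)) → p = 0) :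
    IsSparse n E := by
  intro E' hE' hne
  set S := (nonZeroDivisors (MvPolynomial.supported ℚ (E : Set (XVar n)))).map
    (MvPolynomial.supported ℚ (E : Set (XVar n))).val with hS
  have hdisj : Disjoint (cmIdeal n : Set (MvPolynomial (XVar n) ℚ)) S := by
    rw [Set.disjoint_left]
    rintro _ hp ⟨q, hq, rfl⟩
    exact nonZeroDivisors.ne_zero hq (Subtype.ext (h _ hp q.2))
  obtain ⟨P, hP, hle, hPS⟩ := Ideal.exists_le_prime_disjoint _ _ hdisj
  refine card_le_of_algebraicIndependent (Ideal.Quotient.mk P)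
    (fun p hp => Ideal.Quotient.eq_zero_iff_mem.2 (hle hp)) hne ?_
  rw [algebraicIndependent_iff]
  intro Q hQ
  set g : E' → XVar n := Subtype.val with hg
  have hQ' : Ideal.Quotient.mk P (MvPolynomial.rename g Q) = 0 := by
    rw [← hQ, ← Ideal.Quotient.mkₐ_eq_mk ℚ, ← AlgHom.comp_apply]
    congr 1
    ext e
    simp [hg]
  have hsupp : MvPolynomial.rename g Q ∈ MvPolynomial.supported ℚ (E : Set (XVar n)) := by
    rw [MvPolynomial.mem_supported]
    intro e he
    obtain ⟨e', -, rfl⟩ := Finset.mem_image.1 (MvPolynomial.vars_rename g Q he)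
    exact hE' e'.2
  by_contra hQ0
  refine Set.disjoint_left.1 hPS (Ideal.Quotient.eq_zero_iff_mem.1 hQ')
    ⟨⟨_, hsupp⟩, mem_nonZeroDivisors_of_ne_zero fun h0 => hQ0 ?_, rfl⟩
  exact MvPolynomial.rename_injective g Subtype.val_injective
    (by rw [map_zero]; exact congrArg Subtype.val h0)

lemma IsSparse.vertexSparse {E : Finset (XVar n)} (h : IsSparse n E) :
    VertexSparse (E.map (Function.Embedding.subtype _)) where
  not_isDiag e he := by
    obtain ⟨e', -, rfl⟩ := mem_map.1 he
    exact e'.2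
  card_le X hX := by
    have hcard : #(edgesWithin (E.map (Function.Embedding.subtype _)) X) =
        #(E.filter fun e => e.1 ∈ X.sym2) := by
      rw [edgesWithin, filter_map, card_map]
      rfl
    rw [hcard]
    rcases (E.filter fun e => e.1 ∈ X.sym2).eq_empty_or_nonempty with h0 | hne
    · rw [h0, card_empty]
      omega
    · have hle := h _ (filter_subset _ _) hne
      have hsub : incidentVertices n (E.filter fun e => e.1 ∈ X.sym2) ⊆ X := by
        intro v hv
        obtain ⟨e, he, hve⟩ := (mem_filter.1 hv).2
        exact mem_sym2_iff.1 (mem_filter.1 he).2 v hve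
      have := card_le_card hsub
      omega

/-- The sparse edge sets are independent modulo the Cayley–Menger ideal. -/
lemma IsSparse.independent {E : Finset (XVar n)} (h : IsSparse n E) {p : MvPolynomial (XVar n) ℚ}
    (hp : p ∈ cmIdeal n) (hpE : p ∈ MvPolynomial.supported ℚ (E : Set (XVar n))) : p = 0 := by
  obtain ⟨q, hq⟩ := h.vertexSparse.exists_stressFree
  have hind := hq.exists_polynomial.1.algebraicIndependent
  rw [MvPolynomial.supported_eq_range_rename, AlgHom.mem_range] at hpE
  obtain ⟨Q, rfl⟩ := hpE
  have h0 := map_eq_zero_of_mem_cmIdeal (MvPolynomial.aeval fun e : XVar n =>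
    sqDist (genericJoints (Fin n)) e.1).toRingHom (genericJoints (Fin n)) (fun e => by simp) hp
  have hind' := hind.comp (fun e : (E : Set (XVar n)) =>
    ⟨e.1.1, mem_map_of_mem (Function.Embedding.subtype _) e.2⟩)
    fun e e' he => Subtype.ext (Subtype.ext (Subtype.mk.inj he))
  have hQ : Q = 0 := by
    rw [algebraicIndependent_iff] at hind'
    refine hind' Q ?_
    rw [AlgHom.toRingHom_eq_coe, RingHom.coe_coe, MvPolynomial.aeval_rename] at h0
    exact h0
  rw [hQ, map_zero]

end CayleyMenger

end PlaneRigidity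

/-- The algebraic matroid of the Cayley–Menger ideal is the generic 2-dimensional
rigidity matroid: a set `E` of edges of `K_n` satisfies `CM_n ∩ ℚ[E] = {0}` if and
only if `E` is `(2,3)`-sparse. -/
theorem cmIdeal_independent_iff_sparse (n : ℕ) (hn : 4 ≤ n) (E : Finset (XVar n)) :
    (∀ p ∈ cmIdeal n, p ∈ MvPolynomial.supported ℚ (E : Set (XVar n)) → p = 0) ↔
      IsSparse n E := by
  exact ⟨isSparse_of_independent, fun h _ hp hpE => h.independent hp hpE⟩

end
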